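/- arXiv:2004.02463 — 5 statements merged into one kernel-verified Lean document; each statement's English description precedes it below -/
import Mathlib

section
/- Let F be a p×q complex matrix, H a q×p complex matrix, Φ_v a p×p complex matrix and Φ_r a q×q complex matrix, and suppose I − F·H and I − H·F are invertible. Set P := (I − F·H)⁻¹, Q := (I − H·F)⁻¹, Φ_yu := P·(Φ_v·Hᴴ + F·Φ_r)·Qᴴ and Φ_u := Q·(H·Φ_v·Hᴴ + Φ_r)·Qᴴ, where ᴴ denotes conjugate transpose. Then Φ_yu − F·Φ_u = Φ_v·Hᴴ·Qᴴ. -/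
open Matrix

theorem push_through_inverse {m n R : Type*} [Fintype m] [Fintype n] [DecidableEq m]
    [DecidableEq n] [CommRing R] (F : Matrix m n R) (H : Matrix n m R)
    [Invertible (1 - F * H)] [Invertible (1 - H * F)] :
    F * (1 - H * F)⁻¹ = (1 - F * H)⁻¹ * F := by
  have intertwine : (1 - F * H) * F = F * (1 - H * F) := by
    simp only [Matrix.sub_mul, Matrix.mul_sub, Matrix.one_mul, Matrix.mul_one, Matrix.mul_assoc]
  calc F * (1 - H * F)⁻¹
      = (1 - F * H)⁻¹ * ((1 - F * H) * F) * (1 - H * F)⁻¹ := by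
        rw [← Matrix.mul_assoc, inv_mul_of_invertible, Matrix.one_mul]
    _ = (1 - F * H)⁻¹ * F := by
        rw [intertwine, Matrix.mul_assoc, Matrix.mul_assoc, mul_inv_of_invertible, Matrix.mul_one]

theorem cross_spectrum_identity
    (p q : ℕ)
    (F : Matrix (Fin p) (Fin q) ℂ) (H : Matrix (Fin q) (Fin p) ℂ)
    (Φv : Matrix (Fin p) (Fin p) ℂ) (Φr : Matrix (Fin q) (Fin q) ℂ)
    (hFH : Invertible (1 - F * H)) (hHF : Invertible (1 - H * F)) :
    let P := (1 - F * H)⁻¹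
    let Q := (1 - H * F)⁻¹
    let Φyu := P * (Φv * Hᴴ + F * Φr) * Qᴴ
    let Φu := Q * (H * Φv * Hᴴ + Φr) * Qᴴ
    Φyu - F * Φu = Φv * Hᴴ * Qᴴ := by
  intro P Q Φyu Φu
  have hFQ : F * Q = P * F := push_through_inverse F H
  have hP : P * (1 - F * H) = 1 := inv_mul_of_invertible _
  calc Φyu - F * Φu
      = P * (Φv * Hᴴ + F * Φr) * Qᴴ - F * Q * (H * Φv * Hᴴ + Φr) * Qᴴ := by
        simp only [Φyu, Φu, Matrix.mul_assoc]
    _ = P * (1 - F * H) * (Φv * Hᴴ * Qᴴ) := by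
        rw [hFQ]
        simp only [Matrix.mul_add, Matrix.add_mul, Matrix.mul_sub, Matrix.sub_mul,
          Matrix.mul_one, Matrix.mul_assoc]
        abel
    _ = Φv * Hᴴ * Qᴴ := by rw [hP, Matrix.one_mul]
end

section
/- Let F be a p×q complex matrix, H a q×p complex matrix, Φ_v a p×p complex matrix and Φ_r a q×q complex matrix, with I − F·H and I − H·F invertible. Set P := (I − F·H)⁻¹, Q := (I − H·F)⁻¹, Φ_yu := P·(Φ_v·Hᴴ + F·Φ_r)·Qᴴ and Φ_u := Q·(H·Φ_v·Hᴴ + Φ_r)·Qᴴ, and assume additionally that H·Φ_v·Hᴴ + Φ_r is invertible. Then F = Φ_yu·Φ_u⁻¹ if and only if Φ_v·Hᴴ = 0. -/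
open Matrix

section

variable {m n R : Type*} [Fintype m] [Fintype n] [DecidableEq m] [DecidableEq n] [CommRing R]

/-- The push-through identity. -/
theorem Matrix.mul_inv_one_sub_mul_comm (F : Matrix m n R) (H : Matrix n m R)
    (hFH : IsUnit (1 - F * H).det) (hHF : IsUnit (1 - H * F).det) :
    F * (1 - H * F)⁻¹ = (1 - F * H)⁻¹ * F := by
  have h : (1 - F * H) * F = F * (1 - H * F) := by
    rw [Matrix.sub_mul, Matrix.mul_sub, Matrix.one_mul, Matrix.mul_one, Matrix.mul_assoc]
  calc F * (1 - H * F)⁻¹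
      = (1 - F * H)⁻¹ * ((1 - F * H) * F) * (1 - H * F)⁻¹ := by
        rw [nonsing_inv_mul_cancel_left _ _ hFH]
    _ = (1 - F * H)⁻¹ * F := by
        rw [h, ← Matrix.mul_assoc, mul_nonsing_inv_cancel_right _ _ hHF]

/-- The defect in the identity `F * Φu = Φyu` for a closed loop, where `W` and `Φr` are the noise
terms and `C` is a common right factor. -/
theorem Matrix.closed_loop_cross_sub {k : Type*} (F : Matrix m n R) (H : Matrix n m R)
    (W : Matrix m n R) (Φr : Matrix n n R) (C : Matrix n k R)
    (hFH : IsUnit (1 - F * H).det) (hHF : IsUnit (1 - H * F).det) :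
    (1 - F * H)⁻¹ * (W + F * Φr) * C - F * ((1 - H * F)⁻¹ * (H * W + Φr) * C) = W * C := by
  have h : W + F * Φr - F * (H * W + Φr) = (1 - F * H) * W := by
    rw [Matrix.mul_add, Matrix.sub_mul, Matrix.one_mul, Matrix.mul_assoc]
    abel
  rw [← Matrix.mul_assoc F, ← Matrix.mul_assoc F, mul_inv_one_sub_mul_comm F H hFH hHF,
    ← Matrix.sub_mul, Matrix.mul_assoc _ F, ← Matrix.mul_sub, h,
    nonsing_inv_mul_cancel_left _ _ hFH]

end

theorem F_eq_cross_spectrum_iff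
    (p q : ℕ)
    (F : Matrix (Fin p) (Fin q) ℂ) (H : Matrix (Fin q) (Fin p) ℂ)
    (Φv : Matrix (Fin p) (Fin p) ℂ) (Φr : Matrix (Fin q) (Fin q) ℂ)
    (hFH : Invertible (1 - F * H)) (hHF : Invertible (1 - H * F))
    (hpos : Invertible (H * Φv * Hᴴ + Φr)) :
    let P := (1 - F * H)⁻¹
    let Q := (1 - H * F)⁻¹
    let Φyu := P * (Φv * Hᴴ + F * Φr) * Qᴴ
    let Φu := Q * (H * Φv * Hᴴ + Φr) * Qᴴ
    (F = Φyu * Φu⁻¹ ↔ Φv * Hᴴ = 0) := by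
  intro P Q Φyu Φu
  have hQ : IsUnit Q := isUnit_nonsing_inv_iff.mpr (isUnit_of_invertible _)
  have hQH : IsUnit Qᴴ := hQ.star
  have hQdet : IsUnit Qᴴ.det := (isUnit_iff_isUnit_det _).mp hQH
  have hΦu : IsUnit Φu.det :=
    (isUnit_iff_isUnit_det _).mp ((hQ.mul (isUnit_of_invertible _)).mul hQH)
  have key : Φyu - F * Φu = Φv * Hᴴ * Qᴴ := by
    have h := closed_loop_cross_sub F H (Φv * Hᴴ) Φr Qᴴ
      (isUnit_det_of_invertible _) (isUnit_det_of_invertible _)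
    rwa [← Matrix.mul_assoc H] at h
  constructor
  · intro hF
    have h : F * Φu = Φyu := by
      conv_lhs => rw [hF]
      exact nonsing_inv_mul_cancel_right _ _ hΦu
    rw [h, sub_self] at key
    rw [← mul_nonsing_inv_cancel_right Qᴴ (Φv * Hᴴ) hQdet, ← key, Matrix.zero_mul]
  · intro hW
    rw [hW, Matrix.zero_mul, sub_eq_zero] at key
    rw [key, mul_nonsing_inv_cancel_right _ _ hΦu]
end

section
/- Let A be an n×n complex matrix, B an n×m complex matrix, C₀ an m×n complex matrix and C₁ a p×n complex matrix, with C₀·B invertible. Define Γ := A − B·(C₀·B)⁻¹·C₀·A, and for s ∈ ℂ define M(s) := C₀·B + C₀·A·(sI − A)⁻¹·B and N(s) := C₁·B + C₁·A·(sI − A)⁻¹·B. Then for every s ∈ ℂ such that sI − A, sI − Γ and M(s) are all invertible, one has N(s)·M(s)⁻¹ = C₁·B·(C₀·B)⁻¹ + C₁·Γ·(sI − Γ)⁻¹·B·(C₀·B)⁻¹. -/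
open Matrix

theorem GL_realization_of_F
    (n m p : ℕ)
    (A : Matrix (Fin n) (Fin n) ℂ) (B : Matrix (Fin n) (Fin m) ℂ)
    (C₀ : Matrix (Fin m) (Fin n) ℂ) (C₁ : Matrix (Fin p) (Fin n) ℂ)
    (hC₀B : Invertible (C₀ * B)) :
    let Γ : Matrix (Fin n) (Fin n) ℂ := A - B * (C₀ * B)⁻¹ * C₀ * A
    ∀ s : ℂ,
      Invertible (s • (1 : Matrix (Fin n) (Fin n) ℂ) - A) →
      Invertible (s • (1 : Matrix (Fin n) (Fin n) ℂ) - Γ) →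
      ∀ M : Matrix (Fin m) (Fin m) ℂ,
        M = C₀ * B + C₀ * A * (s • (1 : Matrix (Fin n) (Fin n) ℂ) - A)⁻¹ * B →
        Invertible M →
        ∀ N : Matrix (Fin p) (Fin m) ℂ,
          N = C₁ * B + C₁ * A * (s • (1 : Matrix (Fin n) (Fin n) ℂ) - A)⁻¹ * B →
          N * M⁻¹ =
            C₁ * B * (C₀ * B)⁻¹ +
              C₁ * Γ * (s • (1 : Matrix (Fin n) (Fin n) ℂ) - Γ)⁻¹ * B * (C₀ * B)⁻¹ := by
  intro Γ s hA hΓ M hM hMi N hN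
  set Y := (s • (1 : Matrix (Fin n) (Fin n) ℂ) - A)⁻¹ * B with hY
  set K := B * (C₀ * B)⁻¹ with hK
  have hM' : M = C₀ * (B + A * Y) := by
    rw [hM, hY]; simp only [Matrix.mul_add, Matrix.mul_assoc]
  have hN' : N = C₁ * (B + A * Y) := by
    rw [hN, hY]; simp only [Matrix.mul_add, Matrix.mul_assoc]
  have hAY : (s • (1 : Matrix (Fin n) (Fin n) ℂ) - A) * Y = B := by
    rw [hY, ← Matrix.mul_assoc, Matrix.mul_inv_of_invertible, Matrix.one_mul]
  have hKB : K * (C₀ * B) = B := by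
    rw [hK, Matrix.mul_assoc, Matrix.inv_mul_of_invertible, Matrix.mul_one]
  have hΓ' : Γ = A - K * C₀ * A := rfl
  have hKM : K * M = B + (A - Γ) * Y := by
    rw [hM', hΓ', sub_sub_cancel, Matrix.mul_add, Matrix.mul_add, hKB]
    simp only [Matrix.mul_assoc]
  have hKM' : K * M = (s • (1 : Matrix (Fin n) (Fin n) ℂ) - Γ) * Y := by
    rw [hKM, Matrix.sub_mul A, Matrix.sub_mul _ Γ, ← sub_add_cancel (s • 1 : Matrix _ _ ℂ) A,
      Matrix.add_mul, hAY]
    abel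
  have hSKM : (s • (1 : Matrix (Fin n) (Fin n) ℂ) - Γ)⁻¹ * (K * M) = Y := by
    rw [hKM', ← Matrix.mul_assoc, Matrix.inv_mul_of_invertible, Matrix.one_mul]
  have key : N = (C₁ * K + C₁ * Γ * (s • (1 : Matrix (Fin n) (Fin n) ℂ) - Γ)⁻¹ * K) * M := by
    simp only [Matrix.add_mul, Matrix.mul_assoc]
    rw [hSKM, hKM, hN', ← Matrix.mul_add, Matrix.sub_mul]
    congr 1
    abel
  rw [key, Matrix.mul_inv_cancel_right_of_invertible, hK]
  simp only [Matrix.mul_assoc]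
end

section
/- Let A be an n×n complex matrix, B an n×m complex matrix and C₀ an m×n complex matrix with C₀·B invertible, and define Γ := A − B·(C₀·B)⁻¹·C₀·A and M(s) := C₀·B + C₀·A·(sI − A)⁻¹·B. Then for every s ∈ ℂ such that sI − A, sI − Γ and M(s) are all invertible, one has B·M(s)⁻¹ = (sI − A)·(sI − Γ)⁻¹·B·(C₀·B)⁻¹. -/
open Matrix

/-- A push-through identity for the Schur complement `D + E * R⁻¹ * B`. -/
theorem mul_inv_add_mul_inv_mul {k l S : Type*} [Fintype k] [DecidableEq k] [Fintype l]
    [DecidableEq l] [CommRing S] (R : Matrix k k S) (B : Matrix k l S) (E : Matrix l k S)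
    (D : Matrix l l S) (hR : IsUnit R) (hD : IsUnit D) (hG : IsUnit (R + B * D⁻¹ * E))
    (hM : IsUnit (D + E * R⁻¹ * B)) :
    B * (D + E * R⁻¹ * B)⁻¹ = R * (R + B * D⁻¹ * E)⁻¹ * B * D⁻¹ := by
  rw [Matrix.isUnit_iff_isUnit_det] at hR hD hG hM
  have key : (R + B * D⁻¹ * E) * (R⁻¹ * B) = B * D⁻¹ * (D + E * R⁻¹ * B) := by
    rw [Matrix.add_mul, Matrix.mul_add, mul_nonsing_inv_cancel_left _ _ hR,
      nonsing_inv_mul_cancel_right _ _ hD]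
    simp only [Matrix.mul_assoc]
  have hRB : R⁻¹ * B = (R + B * D⁻¹ * E)⁻¹ * (B * D⁻¹ * (D + E * R⁻¹ * B)) := by
    rw [← key, nonsing_inv_mul_cancel_left _ _ hG]
  calc B * (D + E * R⁻¹ * B)⁻¹
      = R * (R⁻¹ * B) * (D + E * R⁻¹ * B)⁻¹ := by rw [mul_nonsing_inv_cancel_left _ _ hR]
    _ = R * ((R + B * D⁻¹ * E)⁻¹ * (B * D⁻¹ * (D + E * R⁻¹ * B))) *
          (D + E * R⁻¹ * B)⁻¹ := by rw [← hRB]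
    _ = R * (R + B * D⁻¹ * E)⁻¹ * B * D⁻¹ := by
      simp only [← Matrix.mul_assoc R, ← Matrix.mul_assoc (R * _)]
      rw [mul_nonsing_inv_cancel_right _ _ hM]

theorem BMinv_identity
    (n m : ℕ)
    (A : Matrix (Fin n) (Fin n) ℂ) (B : Matrix (Fin n) (Fin m) ℂ)
    (C₀ : Matrix (Fin m) (Fin n) ℂ)
    (hC₀B : Invertible (C₀ * B)) :
    let Γ : Matrix (Fin n) (Fin n) ℂ := A - B * (C₀ * B)⁻¹ * C₀ * A
    ∀ s : ℂ,
      Invertible (s • (1 : Matrix (Fin n) (Fin n) ℂ) - A) →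
      Invertible (s • (1 : Matrix (Fin n) (Fin n) ℂ) - Γ) →
      Invertible (C₀ * B + C₀ * A * (s • (1 : Matrix (Fin n) (Fin n) ℂ) - A)⁻¹ * B) →
      B * (C₀ * B + C₀ * A * (s • (1 : Matrix (Fin n) (Fin n) ℂ) - A)⁻¹ * B)⁻¹ =
        (s • (1 : Matrix (Fin n) (Fin n) ℂ) - A) *
          (s • (1 : Matrix (Fin n) (Fin n) ℂ) - Γ)⁻¹ * B * (C₀ * B)⁻¹ := by
  intro Γ s hA hΓ hM
  have hG : s • (1 : Matrix (Fin n) (Fin n) ℂ) - Γ =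
      (s • (1 : Matrix (Fin n) (Fin n) ℂ) - A) + B * (C₀ * B)⁻¹ * (C₀ * A) := by
    simp only [Γ, Matrix.mul_assoc]
    abel
  have hRG : IsUnit (s • (1 : Matrix (Fin n) (Fin n) ℂ) - A + B * (C₀ * B)⁻¹ * (C₀ * A)) :=
    hG ▸ isUnit_of_invertible _
  rw [hG]
  exact mul_inv_add_mul_inv_mul _ B (C₀ * A) (C₀ * B) (isUnit_of_invertible _)
    (isUnit_of_invertible _) hRG (isUnit_of_invertible _)
end

section
/- Let A be an invertible n×n complex matrix, B an n×m complex matrix, C₀ an m×n complex matrix with C₀·B invertible, and C₁ a p×n complex matrix. Define Γ := (I − B·(C₀·B)⁻¹·C₀)·A. Then for every k ≥ 1, the stacked (k·p)×n matrix whose block rows are C₁·Γ, C₁·Γ², …, C₁·Γᵏ has rank at most n − m. -/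
open Matrix

/-- The oblique projection `1 - B (C B)⁻¹ C` has rank at most `card n - card m`. -/
theorem Matrix.rank_one_sub_mul_inv_mul_le {K n m : Type*} [Field K] [Fintype n] [DecidableEq n]
    [Fintype m] [DecidableEq m] (B : Matrix n m K) (C : Matrix m n K) (h : IsUnit (C * B)) :
    (1 - B * (C * B)⁻¹ * C).rank ≤ Fintype.card n - Fintype.card m := by
  have hzero : (1 - B * (C * B)⁻¹ * C) * B = 0 := by
    rw [Matrix.sub_mul, Matrix.one_mul, Matrix.mul_assoc, Matrix.mul_assoc,
      Matrix.nonsing_inv_mul _ ((Matrix.isUnit_iff_isUnit_det _).mp h), Matrix.mul_one, sub_self]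
  have hsum := Matrix.rank_add_rank_le_card_of_mul_eq_zero hzero
  have hB : Fintype.card m ≤ B.rank :=
    (Matrix.rank_of_isUnit _ h).symm.trans_le (Matrix.rank_mul_le_right C B)
  omega

theorem observability_matrix_rank_bound
    (n m p : ℕ)
    (A : Matrix (Fin n) (Fin n) ℂ) (B : Matrix (Fin n) (Fin m) ℂ)
    (C₀ : Matrix (Fin m) (Fin n) ℂ) (C₁ : Matrix (Fin p) (Fin n) ℂ)
    (hA : Invertible A) (hC₀B : Invertible (C₀ * B)) :
    let Γ : Matrix (Fin n) (Fin n) ℂ := (1 - B * (C₀ * B)⁻¹ * C₀) * A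
    ∀ k : ℕ, 1 ≤ k →
      (Matrix.of (fun (ir : Fin k × Fin p) (j : Fin n) =>
          (C₁ * Γ ^ ((ir.1 : ℕ) + 1)) ir.2 j)).rank ≤ n - m := by
  intro Γ k _
  have hfactor : Matrix.of (fun (ir : Fin k × Fin p) (j : Fin n) =>
      (C₁ * Γ ^ ((ir.1 : ℕ) + 1)) ir.2 j) =
      Matrix.of (fun (ir : Fin k × Fin p) (j : Fin n) => (C₁ * Γ ^ (ir.1 : ℕ)) ir.2 j) * Γ := by
    ext ir j
    rw [Matrix.of_apply, pow_succ, ← Matrix.mul_assoc]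
    rfl
  rw [hfactor]
  calc _ ≤ Γ.rank := Matrix.rank_mul_le_right _ _
    _ ≤ (1 - B * (C₀ * B)⁻¹ * C₀).rank := Matrix.rank_mul_le_left _ _
    _ ≤ n - m := by
      simpa using Matrix.rank_one_sub_mul_inv_mul_le B C₀ (isUnit_of_invertible _)
end
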